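/- arXiv:1406.7698 — 2 statements merged into one kernel-verified Lean document; each statement's English description precedes it below -/
import Mathlib

section
/- (Lemma 1) Let A be an N×K complex matrix with columns a_1,…,a_K, let p ∈ ℝ^K satisfy p_k ≥ 0 for all k, and suppose R = A·diag(p)·Aᴴ is positive definite. Then for every k, p_k · (a_kᴴ R⁻¹ a_k) ≤ 1; equivalently, since a_kᴴ R⁻¹ a_k is a positive real number, p_k ≤ 1/(a_kᴴ R⁻¹ a_k). -/
open Matrix
open scoped ComplexOrder

/-- The real part of the Hermitian form of `A * diagonal p * Aᴴ` is the weighted sum of the squared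
moduli of the entries of `Aᴴ *ᵥ x`. -/
theorem re_star_dotProduct_mul_diagonal_mul_conjTranspose_mulVec {m n : Type*} [Fintype m]
    [Fintype n] [DecidableEq n] (A : Matrix m n ℂ) (p : n → ℝ) (x : m → ℂ) :
    (star x ⬝ᵥ ((A * Matrix.diagonal (fun j => (p j : ℂ)) * Aᴴ) *ᵥ x)).re =
      ∑ j, p j * Complex.normSq ((Aᴴ *ᵥ x) j) := by
  have h : star x ⬝ᵥ ((A * Matrix.diagonal (fun j => (p j : ℂ)) * Aᴴ) *ᵥ x) =
      star (Aᴴ *ᵥ x) ⬝ᵥ (Matrix.diagonal (fun j => (p j : ℂ)) *ᵥ (Aᴴ *ᵥ x)) := by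
    rw [star_mulVec, conjTranspose_conjTranspose, ← dotProduct_mulVec, mulVec_mulVec,
      mulVec_mulVec, Matrix.mul_assoc]
  rw [h, dotProduct, Complex.re_sum]
  refine Finset.sum_congr rfl fun j _ => ?_
  rw [mulVec_diagonal, Pi.star_apply, Complex.star_def, mul_left_comm,
    ← Complex.normSq_eq_conj_mul_self, ← Complex.ofReal_mul, Complex.ofReal_re]

/-- **Lemma 1.** If `R = A·diag(p)·Aᴴ` is positive definite with `p ≥ 0`, then for every
column `a_k` of `A` one has `p_k · (a_kᴴ R⁻¹ a_k) ≤ 1`, i.e. `p_k ≤ 1/(a_kᴴ R⁻¹ a_k)`. -/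
theorem spice_lemma1 {N K : ℕ} (A : Matrix (Fin N) (Fin K) ℂ) (p : Fin K → ℝ)
    (hp : ∀ k, 0 ≤ p k)
    (hR : (A * Matrix.diagonal (fun k => (p k : ℂ)) * Aᴴ).PosDef) :
    ∀ k : Fin K,
      p k * (star (fun i => A i k) ⬝ᵥ
        ((A * Matrix.diagonal (fun j => (p j : ℂ)) * Aᴴ)⁻¹ *ᵥ (fun i => A i k))).re ≤ 1 := by
  intro k
  set R := A * Matrix.diagonal (fun j => (p j : ℂ)) * Aᴴ with hR_def
  set a : Fin N → ℂ := fun i => A i k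
  set x := R⁻¹ *ᵥ a with hx
  have hRx : R *ᵥ x = a := by
    rw [hx, mulVec_mulVec, mul_nonsing_inv _ ((isUnit_iff_isUnit_det R).1 hR.isUnit), one_mulVec]
  have hform : (star a ⬝ᵥ x).re = ∑ j, p j * Complex.normSq ((Aᴴ *ᵥ x) j) := by
    rw [← re_star_dotProduct_mul_diagonal_mul_conjTranspose_mulVec, ← hR_def, hRx,
      star_dotProduct, Complex.star_def, Complex.conj_re]
  have hk : p k * Complex.normSq (star a ⬝ᵥ x) ≤ (star a ⬝ᵥ x).re := by
    rw [hform]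
    exact Finset.single_le_sum (f := fun j => p j * Complex.normSq ((Aᴴ *ᵥ x) j))
      (fun j _ => mul_nonneg (hp j) (Complex.normSq_nonneg _)) (Finset.mem_univ k)
  have hsq : p k * ((star a ⬝ᵥ x).re * (star a ⬝ᵥ x).re) ≤ (star a ⬝ᵥ x).re :=
    (mul_le_mul_of_nonneg_left (Complex.re_sq_le_normSq _) (hp k)).trans hk
  nlinarith [mul_le_mul_of_nonneg_left hsq (hp k)]
end

section
/- (Ordering of the SLIM, LIKES and IAA weights) Let A ∈ ℂ^{N×K} with columns a_1,…,a_K, let p ∈ ℝ^K with p_k > 0 for all k, and suppose R = A·diag(p)·Aᴴ is positive definite. Then for every k the IAA weight is at most the LIKES weight, which is at most the SLIM weight: p_k·(a_kᴴ R⁻¹ a_k)² ≤ a_kᴴ R⁻¹ a_k ≤ 1/p_k, where a_kᴴR⁻¹a_k is a nonnegative real number. -/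
open Matrix
open scoped ComplexOrder

/-- If `A·diag(p)·Aᴴ` maps `x` to the column `a_k`, then `p_k·(Re a_kᴴx)² ≤ Re a_kᴴx`. -/
theorem mul_re_sq_le_re_of_mulVec_eq_col {m n : Type*} [Fintype m] [Fintype n] [DecidableEq n]
    (A : Matrix m n ℂ) (p : n → ℝ) (hp : ∀ j, 0 ≤ p j) (k : n) (x : m → ℂ)
    (hx : (A * Matrix.diagonal (fun j => (p j : ℂ)) * Aᴴ) *ᵥ x = fun i => A i k) :
    p k * ((star (fun i => A i k) ⬝ᵥ x).re) ^ 2 ≤ (star (fun i => A i k) ⬝ᵥ x).re := by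
  set w : n → ℂ := Aᴴ *ᵥ x with hw
  have hwk : star (fun i => A i k) ⬝ᵥ x = w k := rfl
  have hform : star w ⬝ᵥ (Matrix.diagonal (fun j => (p j : ℂ)) *ᵥ w) = star (w k) := by
    rw [← hwk, ← star_dotProduct, ← hx, hw, star_mulVec, conjTranspose_conjTranspose,
      ← dotProduct_mulVec, mulVec_mulVec, mulVec_mulVec, Matrix.mul_assoc]
  have hre : ∑ j, p j * Complex.normSq (w j) = (w k).re := by
    have h := congrArg Complex.re hform
    simp only [dotProduct, mulVec_diagonal, Complex.re_sum, Pi.star_apply] at h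
    rw [show (w k).re = (star (w k)).re from rfl, ← h]
    refine Finset.sum_congr rfl fun j _ => ?_
    simp [Complex.normSq_apply]
    ring
  have hsingle : p k * Complex.normSq (w k) ≤ ∑ j, p j * Complex.normSq (w j) :=
    Finset.single_le_sum (f := fun j => p j * Complex.normSq (w j))
      (fun j _ => mul_nonneg (hp j) (Complex.normSq_nonneg _)) (Finset.mem_univ k)
  have hsq : (w k).re ^ 2 ≤ Complex.normSq (w k) := by
    rw [Complex.normSq_apply]
    nlinarith [sq_nonneg (w k).im]
  rw [hwk]
  exact (mul_le_mul_of_nonneg_left hsq (hp k)).trans (hsingle.trans hre.le)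

/-- **Ordering of the IAA, LIKES and SLIM weights.** For `p > 0` with
`R = A·diag(p)·Aᴴ` positive definite, for every `k`:
`p_k·(a_kᴴR⁻¹a_k)² ≤ a_kᴴR⁻¹a_k ≤ 1/p_k`. -/
theorem weight_ordering {N K : ℕ} (A : Matrix (Fin N) (Fin K) ℂ) (p : Fin K → ℝ)
    (hp : ∀ k, 0 < p k)
    (hR : (A * Matrix.diagonal (fun k => (p k : ℂ)) * Aᴴ).PosDef) :
    ∀ k : Fin K,
      p k * ((star (fun i => A i k) ⬝ᵥ
          ((A * Matrix.diagonal (fun j => (p j : ℂ)) * Aᴴ)⁻¹ *ᵥ (fun i => A i k))).re) ^ 2 ≤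
        (star (fun i => A i k) ⬝ᵥ
          ((A * Matrix.diagonal (fun j => (p j : ℂ)) * Aᴴ)⁻¹ *ᵥ (fun i => A i k))).re ∧
      (star (fun i => A i k) ⬝ᵥ
          ((A * Matrix.diagonal (fun j => (p j : ℂ)) * Aᴴ)⁻¹ *ᵥ (fun i => A i k))).re ≤
        1 / p k := by
  intro k
  have hunit := (Matrix.isUnit_iff_isUnit_det _).mp hR.isUnit
  have hle := mul_re_sq_le_re_of_mulVec_eq_col A p (fun j => (hp j).le) k
    ((A * Matrix.diagonal (fun j => (p j : ℂ)) * Aᴴ)⁻¹ *ᵥ (fun i => A i k))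
    (by rw [mulVec_mulVec, Matrix.mul_nonsing_inv _ hunit, one_mulVec])
  refine ⟨hle, ?_⟩
  rw [le_div_iff₀ (hp k)]
  have hpk := hp k
  by_contra! h
  nlinarith
end
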